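/- For any hypergraph communication situation (N,v,H) and any hyperlink e∈H, the Shapley payoffs of the uniform hyperlink game aggregate to the Shapley payoff of the conference game: Σ_{l∈U(H)(e)} Sh_l(U(H),w) = Sh_e(H,v^N). -/

import Mathlib

open scoped Classical
open Finset

noncomputable section

namespace HGGame

/-! ## Generic hypergraph notions -/

variable {α : Type*}

/-- Two nodes are linked if they lie in a common hyperlink of `E`. -/
def Linked (E : Finset (Finset α)) (a b : α) : Prop :=
  ∃ e ∈ E, a ∈ e ∧ b ∈ e

/-- The component of `i` in the subhypergraph of `(α, E)` induced by the ground set `S`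
(only hyperlinks contained in `S` count). -/
def compOf (E : Finset (Finset α)) (S : Finset α) (i : α) : Finset α :=
  S.filter (fun j => Relation.ReflTransGen (Linked (E.filter (fun e => e ⊆ S))) i j)

/-- The set `S/E` of components of the subhypergraph induced by `S`. -/
def components (E : Finset (Finset α)) (S : Finset α) : Finset (Finset α) :=
  S.image (compOf E S)

/-- The hypergraph-restricted worth `v^E(S) = Σ_{T ∈ S/E} v(T)`. -/
def restrictedWorth (v : Finset α → ℝ) (E : Finset (Finset α)) (S : Finset α) : ℝ :=
  ∑ T ∈ components E S, v T

/-! ## Shapley value -/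

/-- The set `σ^i` of players preceding `i` in the ordering `σ`. -/
def preceding {M : Type*} [Fintype M] (σ : M ≃ Fin (Fintype.card M)) (i : M) : Finset M :=
  Finset.univ.filter (fun j => σ j < σ i)

/-- The marginal contribution `m^σ_i(u) = u(σ^i ∪ {i}) - u(σ^i)`. -/
def marginal {M : Type*} [Fintype M] (u : Finset M → ℝ) (σ : M ≃ Fin (Fintype.card M))
    (i : M) : ℝ :=
  u (insert i (preceding σ i)) - u (preceding σ i)

/-- The Shapley value of the TU-game `(M, u)`. -/
def shapley {M : Type*} [Fintype M] (u : Finset M → ℝ) (i : M) : ℝ :=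
  ((Fintype.card M).factorial : ℝ)⁻¹ * ∑ σ : M ≃ Fin (Fintype.card M), marginal u σ i

/-- The Harsanyi dividend `λ_T(u) = Σ_{∅ ≠ S ⊆ T} (-1)^{|T|-|S|} u(S)`. -/
def dividend {M : Type*} (u : Finset M → ℝ) (T : Finset M) : ℝ :=
  ∑ S ∈ T.powerset.filter (fun S => S ≠ ∅), (-1 : ℝ) ^ (T.card - S.card) * u S

/-! ## Hypergraph communication situations -/

variable {N : Type*} [Fintype N] [DecidableEq N]

/-- The conference game `(H, v^N)`, a TU-game with player set `H`:
`v^N(H') = Σ_{T ∈ N/H'} v(T)`. -/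
def confGame (v : Finset N → ℝ) (H : Finset (Finset N)) (F : Finset {e // e ∈ H}) : ℝ :=
  restrictedWorth v (F.image Subtype.val) Finset.univ

/-- The position value `π_i(N,v,H) = Σ_{e ∈ H_i} (1/|e|) · Sh_e(H, v^N)`. -/
def positionValue (v : Finset N → ℝ) (H : Finset (Finset N)) (i : N) : ℝ :=
  ∑ e ∈ H.attach.filter (fun e => i ∈ e.val),
    ((e.val.card : ℝ))⁻¹ * shapley (confGame v H) e

/-! ## The uniform hyperlink game -/

/-- The type of agents `(i, e, k)` of the uniform hyperlink game. -/
abbrev UElem (N : Type*) := N × Finset N × ℕ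

/-- `η(H)`: the least common multiple of the hyperlink sizes. -/
def eta (H : Finset (Finset N)) : ℕ := H.lcm Finset.card

/-- `U(H)(i,e) = {(i,e,k) : k = 1, …, η(H)/|e|}`. -/
def UHie (H : Finset (Finset N)) (i : N) (e : Finset N) : Finset (UElem N) :=
  (Finset.Icc 1 (eta H / e.card)).image fun k => (i, e, k)

/-- `U(H)(i) = ∪_{e ∈ H_i} U(H)(i,e)`. -/
def UHi (H : Finset (Finset N)) (i : N) : Finset (UElem N) :=
  (H.filter (fun e => i ∈ e)).biUnion fun e => UHie H i e

/-- `U(H)(e) = ∪_{i ∈ e} U(H)(i,e)`. -/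
def UHe (H : Finset (Finset N)) (e : Finset N) : Finset (UElem N) :=
  e.biUnion fun i => UHie H i e

/-- `U(H) = ∪_{i ∈ N} U(H)(i)`. -/
def UH (H : Finset (Finset N)) : Finset (UElem N) :=
  Finset.univ.biUnion fun i : N => UHi H i

/-- `H[S] = {e ∈ H : U(H)(e) ⊆ S}`. -/
def Hof (H : Finset (Finset N)) (S : Finset (UElem N)) : Finset (Finset N) :=
  H.filter fun e => UHe H e ⊆ S

/-- The characteristic function `w(S) = Σ_{R ∈ N/H[S]} v(R)` of the uniform hyperlink game. -/
def uw (v : Finset N → ℝ) (H : Finset (Finset N)) (S : Finset (UElem N)) : ℝ :=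
  restrictedWorth v (Hof H S) Finset.univ

/-- The uniform hyperlink game `(U(H), w)` as a TU-game with player set `U(H)`. -/
def uGame (v : Finset N → ℝ) (H : Finset (Finset N)) (F : Finset {l // l ∈ UH H}) : ℝ :=
  uw v H (F.image Subtype.val)

/-- The coalition `{b | t b < t a}` of players arriving before `a`, when player `b` arrives at
time `t b`. -/
def arrivedBefore {A B : Type*} [Fintype A] [LinearOrder B] (t : A → B) (a : A) : Finset A :=
  Finset.univ.filter fun b => t b < t a

/-- The marginal contribution of `a` when player `b` arrives at time `t b`. -/
def arrivalMarginal {A B : Type*} [Fintype A] [LinearOrder B] (u : Finset A → ℝ) (t : A → B)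
    (a : A) : ℝ :=
  u (insert a (arrivedBefore t a)) - u (arrivedBefore t a)

/-- An injective arrival time induces an ordering of the players. -/
theorem exists_ordering_of_injective {A B : Type*} [Fintype A] [LinearOrder B] (t : A → B)
    (ht : Function.Injective t) :
    ∃ τ : A ≃ Fin (Fintype.card A), ∀ a b, τ a < τ b ↔ t a < t b := by
  let : LinearOrder A := LinearOrder.lift' t ht
  refine ⟨(Fintype.orderIsoFinOfCardEq A rfl).symm.toEquiv, fun a b => ?_⟩
  exact (Fintype.orderIsoFinOfCardEq A rfl).symm.lt_iff_lt

/-- Averaging over all relabellings of the players turns any injective arrival time into the sum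
of marginal contributions over all orderings. -/
theorem sum_perm_arrivalMarginal {A B : Type*} [Fintype A] [LinearOrder B] (u : Finset A → ℝ)
    (t : A → B) (ht : Function.Injective t) (a : A) :
    ∑ π : Equiv.Perm A, arrivalMarginal u (t ∘ π) a
      = ∑ τ : A ≃ Fin (Fintype.card A), marginal u τ a := by
  obtain ⟨τ, hτ⟩ := exists_ordering_of_injective t ht
  refine Fintype.sum_equiv (Equiv.equivCongr (Equiv.refl A) τ) _ _ fun π => ?_
  have h : arrivedBefore (t ∘ π) a = preceding (Equiv.equivCongr (Equiv.refl A) τ π) a := by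
    ext b
    simp [arrivedBefore, preceding, hτ]
  rw [arrivalMarginal, marginal, h]

/-- The players of `A` all of whose representatives under `p` lie in `S`. -/
def completed {P A : Type*} [Fintype A] (p : P → A) (S : Finset P) : Finset A :=
  Finset.univ.filter fun a => ∀ l, p l = a → l ∈ S

/-- In a fixed ordering of the representatives, the only one of `a` with a possibly nonzero
marginal contribution is the last; together they contribute the marginal contribution of `a` when
every player arrives together with its last representative. -/
theorem sum_marginal_completed {P A : Type*} [Fintype P] [Fintype A] (p : P → A)
    (u : Finset A → ℝ) (σ : P ≃ Fin (Fintype.card P)) (last : A → P)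
    (hlast : ∀ a, p (last a) = a) (hmax : ∀ l, σ l ≤ σ (last (p l))) (a : A) :
    ∑ l ∈ Finset.univ.filter (fun l => p l = a), marginal (fun S => u (completed p S)) σ l
      = arrivalMarginal u (fun b => σ (last b)) a := by
  have hbefore : completed p (preceding σ (last a)) = arrivedBefore (fun b => σ (last b)) a := by
    ext b
    simp only [completed, preceding, arrivedBefore, Finset.mem_filter, Finset.mem_univ, true_and]
    refine ⟨fun h => h _ (hlast b), ?_⟩
    rintro h l rfl
    exact (hmax l).trans_lt h
  have hafter : completed p (insert (last a) (preceding σ (last a)))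
      = insert a (arrivedBefore (fun b => σ (last b)) a) := by
    ext b
    simp only [completed, preceding, arrivedBefore, Finset.mem_filter, Finset.mem_univ, true_and,
      Finset.mem_insert]
    constructor
    · intro h
      refine (h _ (hlast b)).imp (fun h' => ?_) id
      rw [← hlast b, h', hlast]
    · rintro (rfl | h) l rfl
      · exact (hmax l).eq_or_lt.imp (fun h => σ.injective h) id
      · exact Or.inr ((hmax l).trans_lt h)
  rw [Finset.sum_eq_single (last a)]
  · rw [marginal, arrivalMarginal, hbefore, hafter]
  · intro l hl hne
    obtain rfl := (Finset.mem_filter.1 hl).2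
    have hlt : σ l < σ (last (p l)) :=
      lt_of_le_of_ne (hmax l) fun h => hne (σ.injective h)
    rw [marginal, sub_eq_zero]
    congr 1
    ext b
    simp only [completed, preceding, Finset.mem_filter, Finset.mem_univ, true_and,
      Finset.mem_insert]
    refine ⟨fun h l' hl' => (h l' hl').resolve_left ?_, fun h l' hl' => Or.inr (h l' hl')⟩
    rintro rfl
    subst hl'
    rcases h _ (hlast _) with h' | h'
    · exact hne h'.symm
    · exact (hlt.trans h').false
  · intro h
    exact absurd (by simp [hlast a]) h

/-- A permutation of `A` lifts along a map `p : P → A` whose fibers all have the same size. -/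
theorem exists_perm_lift {P A : Type*} [Fintype P] (p : P → A) (n : ℕ)
    (hp : ∀ a, Nat.card {l // p l = a} = n) (π : Equiv.Perm A) :
    ∃ ψ : Equiv.Perm P, ∀ l, p (ψ l) = π (p l) := by
  have hfiber : ∀ a, Nonempty ({l // (π ∘ p) l = a} ≃ {l // p l = a}) := fun a => by
    refine ⟨(Equiv.subtypeEquivRight fun l => ?_).trans
      ((Finite.equivFinOfCardEq (hp (π.symm a))).trans (Finite.equivFinOfCardEq (hp a)).symm)⟩
    simp [Equiv.eq_symm_apply]
  exact ⟨Equiv.ofFiberEquiv fun a => (hfiber a).some, Equiv.ofFiberEquiv_map _⟩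

/-- If every player of a game is split into the same positive number of representatives, a player
being present once all of its representatives are, then the Shapley payoffs of the representatives
of a player add up to the Shapley payoff of that player. -/
theorem sum_shapley_completed {P A : Type*} [Fintype P] [Fintype A] (p : P → A) (n : ℕ)
    (hn : 0 < n) (hp : ∀ a, Nat.card {l // p l = a} = n) (u : Finset A → ℝ) (a : A) :
    ∑ l ∈ Finset.univ.filter (fun l => p l = a), shapley (fun S => u (completed p S)) l
      = shapley u a := by
  have hex : ∀ (σ : P ≃ Fin (Fintype.card P)) (b : A),
      ∃ l, p l = b ∧ ∀ l', p l' = b → σ l' ≤ σ l := fun σ b => by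
    obtain ⟨l₀, hl₀⟩ : Nonempty {l // p l = b} := (Nat.card_pos_iff.1 (by rw [hp]; exact hn)).1
    obtain ⟨l, hl, hmax⟩ := Finset.exists_max_image
      (Finset.univ.filter fun l => p l = b) σ ⟨l₀, by simpa using hl₀⟩
    exact ⟨l, by simpa using hl, fun l' hl' => hmax l' (by simpa using hl')⟩
  choose last hlast hmax using hex
  set t : (P ≃ Fin (Fintype.card P)) → A → Fin (Fintype.card P) := fun σ b => σ (last σ b)
    with ht
  have ht_inj : ∀ σ, Function.Injective (t σ) := fun σ b c h => by
    rw [← hlast σ b, ← hlast σ c, σ.injective h]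
  have hsymm : ∀ π : Equiv.Perm A, ∑ σ, arrivalMarginal u (t σ ∘ π) a
      = ∑ σ, arrivalMarginal u (t σ) a := fun π => by
    obtain ⟨ψ, hψ⟩ := exists_perm_lift p n hp π
    refine Fintype.sum_equiv (Equiv.equivCongr ψ.symm (Equiv.refl _)) _ _ fun σ => ?_
    congr 1
    funext b
    set σ' : P ≃ Fin (Fintype.card P) := Equiv.equivCongr ψ.symm (Equiv.refl _) σ with hσ'
    have happ : ∀ l, σ' l = σ (ψ l) := fun l => by simp [hσ']
    apply le_antisymm
    · have hpre : p (ψ.symm (last σ (π b))) = b := π.injective (by rw [← hψ]; simp [hlast])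
      simpa [ht, happ] using hmax σ' b _ hpre
    · have := hmax σ (π b) (ψ (last σ' b)) (by rw [hψ, hlast])
      simpa [ht, happ] using this
  have hkey : ((Fintype.card A).factorial : ℝ) * ∑ σ, arrivalMarginal u (t σ) a
      = ((Fintype.card P).factorial : ℝ) * ∑ τ : A ≃ Fin (Fintype.card A), marginal u τ a := by
    calc ((Fintype.card A).factorial : ℝ) * ∑ σ, arrivalMarginal u (t σ) a
        = ∑ π : Equiv.Perm A, ∑ σ, arrivalMarginal u (t σ ∘ π) a := by
          simp [hsymm, Fintype.card_perm]
      _ = ∑ σ, ∑ π : Equiv.Perm A, arrivalMarginal u (t σ ∘ π) a := Finset.sum_comm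
      _ = _ := by
          simp [sum_perm_arrivalMarginal u (t _) (ht_inj _),
            Fintype.card_equiv (Fintype.equivFin P)]
  have hsum : ∑ l ∈ Finset.univ.filter (fun l => p l = a),
      ∑ σ, marginal (fun S => u (completed p S)) σ l = ∑ σ, arrivalMarginal u (t σ) a := by
    rw [Finset.sum_comm]
    exact Finset.sum_congr rfl fun σ _ =>
      sum_marginal_completed p u σ (last σ) (hlast σ) (fun l => hmax σ _ l rfl) a
  simp only [shapley]
  rw [← Finset.mul_sum, hsum]
  have hA : ((Fintype.card A).factorial : ℝ) ≠ 0 := by positivity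
  have hP : ((Fintype.card P).factorial : ℝ) ≠ 0 := by positivity
  rw [inv_mul_eq_div, inv_mul_eq_div, div_eq_div_iff hP hA, mul_comm, hkey, mul_comm]

theorem mem_UHe {N : Type*} [DecidableEq N] {H : Finset (Finset N)} {e : Finset N} {l : UElem N} :
    l ∈ UHe H e ↔ l.1 ∈ e ∧ l.2.1 = e ∧ l.2.2 ∈ Finset.Icc 1 (eta H / e.card) := by
  obtain ⟨i, f, k⟩ := l
  simp only [UHe, UHie, Finset.mem_biUnion, Finset.mem_image, Prod.mk.injEq]
  constructor
  · rintro ⟨_, hi, _, hk, rfl, rfl, rfl⟩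
    exact ⟨hi, rfl, hk⟩
  · rintro ⟨hi, rfl, hk⟩
    exact ⟨i, hi, k, hk, rfl, rfl, rfl⟩

theorem mem_UH {H : Finset (Finset N)} {l : UElem N} :
    l ∈ UH H ↔ l.2.1 ∈ H ∧ l ∈ UHe H l.2.1 := by
  obtain ⟨i, f, k⟩ := l
  simp only [mem_UHe, UH, UHi, UHie, Finset.mem_biUnion, Finset.mem_image, Finset.mem_filter,
    Finset.mem_univ, true_and, Prod.mk.injEq]
  constructor
  · rintro ⟨_, _, ⟨hf, hi⟩, _, hk, rfl, rfl, rfl⟩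
    exact ⟨hf, hi, hk⟩
  · rintro ⟨hf, hi, hk⟩
    exact ⟨i, f, ⟨hf, hi⟩, k, hk, rfl, rfl, rfl⟩

theorem card_UHe {N : Type*} [DecidableEq N] {H : Finset (Finset N)} {e : Finset N}
    (he : e ∈ H) :
    (UHe H e).card = eta H := by
  have h : UHe H e
      = (e ×ˢ Finset.Icc 1 (eta H / e.card)).image fun x : N × ℕ => (x.1, e, x.2) := by
    ext ⟨i, f, k⟩
    simp only [mem_UHe, Finset.mem_image, Finset.mem_product, Prod.mk.injEq, Prod.exists]
    constructor
    · rintro ⟨hi, rfl, hk⟩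
      exact ⟨i, k, ⟨hi, hk⟩, rfl, rfl, rfl⟩
    · rintro ⟨_, _, ⟨hi, hk⟩, rfl, rfl, rfl⟩
      exact ⟨hi, rfl, hk⟩
  rw [h, Finset.card_image_of_injective, Finset.card_product, Nat.card_Icc, Nat.add_sub_cancel]
  · exact Nat.mul_div_cancel' (Finset.dvd_lcm he)
  · rintro ⟨i, k⟩ ⟨j, m⟩ hij
    simpa using hij

/-- The hyperlink to which an agent of the uniform hyperlink game belongs. -/
def hyperlinkOf (H : Finset (Finset N)) (l : {l // l ∈ UH H}) : {e // e ∈ H} :=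
  ⟨l.val.2.1, (mem_UH.1 l.property).1⟩

theorem hyperlinkOf_eq_iff {H : Finset (Finset N)} (l : {l // l ∈ UH H}) (e : {e // e ∈ H}) :
    hyperlinkOf H l = e ↔ l.val ∈ UHe H e.val := by
  constructor
  · rintro rfl
    exact (mem_UH.1 l.property).2
  · exact fun h => Subtype.ext (mem_UHe.1 h).2.1

theorem UHe_subset_UH {H : Finset (Finset N)} {e : Finset N} (he : e ∈ H) : UHe H e ⊆ UH H :=
  fun l hl => by
    obtain rfl := (mem_UHe.1 hl).2.1
    exact mem_UH.2 ⟨he, hl⟩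

theorem card_hyperlinkOf_fiber (H : Finset (Finset N)) (e : {e // e ∈ H}) :
    Nat.card {l // hyperlinkOf H l = e} = eta H := by
  rw [← card_UHe e.property, ← Fintype.card_coe, ← Nat.card_eq_fintype_card]
  exact Nat.card_congr
    { toFun := fun l => ⟨l.val.val, (hyperlinkOf_eq_iff _ _).1 l.property⟩
      invFun := fun l =>
        ⟨⟨l.val, UHe_subset_UH e.property l.property⟩, (hyperlinkOf_eq_iff _ _).2 l.property⟩
      left_inv := fun _ => rfl
      right_inv := fun _ => rfl }

theorem eta_pos {N : Type*} {H : Finset (Finset N)} (hH : ∀ e ∈ H, 1 < e.card) : 0 < eta H := by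
  refine Nat.pos_of_ne_zero fun h => ?_
  obtain ⟨e, he, h0⟩ := Finset.lcm_eq_zero_iff.1 h
  have := hH e he
  omega

/-- The uniform hyperlink game is the conference game played by the hyperlinks all of whose
agents are present. -/
theorem uGame_eq_confGame_completed (v : Finset N → ℝ) (H : Finset (Finset N)) :
    uGame v H = fun S => confGame v H (completed (hyperlinkOf H) S) := by
  funext S
  rw [uGame, uw, confGame]
  congr 1
  ext f
  simp only [Hof, completed, Finset.mem_filter, Finset.mem_image, Finset.mem_univ, true_and,
    Subtype.exists, exists_and_right, exists_eq_right]
  constructor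
  · rintro ⟨hf, hS⟩
    refine ⟨hf, fun l hle => ?_⟩
    obtain ⟨l', hmem, hl'⟩ := Finset.mem_image.1 (hS ((hyperlinkOf_eq_iff l ⟨f, hf⟩).1 hle))
    rwa [← Subtype.ext hl']
  · rintro ⟨hf, hS⟩
    refine ⟨hf, fun l hl => ?_⟩
    have hlU := UHe_subset_UH hf hl
    exact Finset.mem_image.2 ⟨⟨l, hlU⟩, hS ⟨l, hlU⟩ ((hyperlinkOf_eq_iff _ ⟨f, hf⟩).2 hl), rfl⟩

/-- The Shapley payoffs of the uniform hyperlink game aggregate, over `U(H)(e)`,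
to the Shapley payoff of the conference game at the hyperlink `e`. -/
theorem uniform_hyperlink_shapley_aggregates
    {N : Type*} [Fintype N] [DecidableEq N]
    (v : Finset N → ℝ) (H : Finset (Finset N))
    (hN : 2 ≤ Fintype.card N)
    (hv0 : v ∅ = 0) (hzn : ∀ i : N, v {i} = 0)
    (hH : ∀ e ∈ H, 1 < e.card)
    (e : Finset N) (he : e ∈ H) :
    ∑ l ∈ (UH H).attach.filter (fun l => l.val ∈ UHe H e),
        shapley (uGame v H) l
      = shapley (confGame v H) ⟨e, he⟩ := by
  have h := sum_shapley_completed (hyperlinkOf H) (eta H) (eta_pos hH)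
    (card_hyperlinkOf_fiber H) (confGame v H) ⟨e, he⟩
  rw [← uGame_eq_confGame_completed] at h
  rw [← h]
  refine Finset.sum_congr ?_ fun _ _ => rfl
  ext l
  simp [hyperlinkOf_eq_iff]

end HGGame
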